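/- Let d = 2 and let G_N = (−Δ_{Λ_N})^{-1} be the inverse Dirichlet Laplacian on the box Λ_N = {0,…,N−1}² ⊂ Z², with the convention G_N(w,z) = 0 whenever w ∉ Λ_N. Then there is a constant c > 0 such that for all N ≥ 2, Σ_{e} Σ_{z∈Λ_N} (G_N(x_e, z) − G_N(y_e, z))² ≥ c N² log N, where the outer sum runs over all nearest-neighbor edges e = {x_e, y_e} of Z² with at least one endpoint in Λ_N. In particular, the per-site value of this double-gradient of Δ_{Λ_N}^{-2} diverges as N → ∞: in two dimensions the disorder term of the random field Gaussian model grows even after taking gradients in both arguments. -/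

import Mathlib

open scoped Classical BigOperators
open MeasureTheory Filter

noncomputable section

/-- A site of the lattice `ℤ²`. -/
abbrev Site2 := Fin 2 → ℤ

/-- The ℓ¹ distance on `ℤ²`; nearest neighbors are at ℓ¹ distance 1. -/
def l1dist (x y : Site2) : ℤ := ∑ i, |x i - y i|

/-- The box `{a,…,b}²` as a Finset of `ℤ²`. -/
def latBox (a b : ℤ) : Finset Site2 := Fintype.piFinset fun _ => Finset.Icc a b

/-- The box `Λ_N = {0,…,N−1}²`. -/
def ΛN (N : ℕ) : Finset Site2 := latBox 0 ((N : ℤ) - 1)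

/-- The Dirichlet Laplacian `−Δ_Λ` of a finite region `Λ ⊂ ℤ²`:
`(−Δ_Λ f)(x) = 4·f(x) − Σ_{y∈Λ, ‖y−x‖₁=1} f(y)`. -/
def dirLap (Λ : Finset Site2) : Matrix Λ Λ ℝ := fun x y =>
  if (x : Site2) = (y : Site2) then (4 : ℝ)
  else if l1dist (x : Site2) (y : Site2) = 1 then -1 else 0

/-- The inverse Dirichlet Laplacian (Green function) `G_N = (−Δ_{Λ_N})⁻¹` on `Λ_N`,
extended by `0` whenever one argument lies outside `Λ_N`. -/
def greenN (N : ℕ) (w z : Site2) : ℝ :=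
  if hw : w ∈ ΛN N then
    if hz : z ∈ ΛN N then (dirLap (ΛN N))⁻¹ ⟨w, hw⟩ ⟨z, hz⟩ else 0
  else 0

/-- The double-gradient sum `Σ_e Σ_{z∈Λ_N} (G_N(x_e,z) − G_N(y_e,z))²`, where `e = {x_e, y_e}`
runs over all nearest-neighbor edges of `ℤ²` with at least one endpoint in `Λ_N`.
(Each such edge is written uniquely as `{x, x + eᵢ}` with `x ∈ {−1,…,N−1}²`, `i ∈ {0,1}`.) -/
def gradGradSum (N : ℕ) : ℝ :=
  ∑ x ∈ latBox (-1) ((N : ℤ) - 1), ∑ i : Fin 2,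
    if x ∈ ΛN N ∨ x + Pi.single i 1 ∈ ΛN N then
      ∑ z ∈ ΛN N, (greenN N x z - greenN N (x + Pi.single i 1) z) ^ 2
    else 0

lemma mem_latBox {a b : ℤ} {x : Site2} :
    x ∈ latBox a b ↔ (a ≤ x 0 ∧ x 0 ≤ b) ∧ (a ≤ x 1 ∧ x 1 ≤ b) := by
  simp [latBox, Fintype.mem_piFinset, Fin.forall_fin_two]

/-- The Dirichlet form of the edges meeting `Λ_N`. -/
def edgeForm (N : ℕ) (u f : Site2 → ℝ) : ℝ :=
  ∑ x ∈ latBox (-1) ((N : ℤ) - 1), ∑ i : Fin 2,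
    (u x - u (x + Pi.single i 1)) * (f x - f (x + Pi.single i 1))

lemma mem_outer_of_mem_ΛN {N : ℕ} {x : Site2} (hx : x ∈ ΛN N) :
    x ∈ latBox (-1) ((N : ℤ) - 1) := by
  rw [ΛN, mem_latBox] at hx
  rw [mem_latBox]
  omega

lemma sub_single_mem_outer {N : ℕ} {x : Site2} (hx : x ∈ ΛN N) (i : Fin 2) :
    x - Pi.single i 1 ∈ latBox (-1) ((N : ℤ) - 1) := by
  rw [ΛN, mem_latBox] at hx
  rw [mem_latBox]
  fin_cases i <;> simp <;> omega

lemma sum_outer_shift {N : ℕ} (F : Site2 → ℝ) (hF : ∀ x ∉ ΛN N, F x = 0) (i : Fin 2) :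
    ∑ x ∈ latBox (-1) ((N : ℤ) - 1), F (x + Pi.single i 1) = ∑ x ∈ ΛN N, F x := by
  have hmap := Finset.sum_map (latBox (-1) ((N : ℤ) - 1)) (addRightEmbedding (Pi.single i 1)) F
  simp only [addRightEmbedding_apply] at hmap
  rw [← hmap]
  symm
  refine Finset.sum_subset (fun x hx => ?_) fun x _ hx => hF x hx
  rw [Finset.mem_map]
  exact ⟨x - Pi.single i 1, sub_single_mem_outer hx i, by simp⟩

/-- Summation by parts. -/
lemma edgeForm_eq_sum_mul_laplacian {N : ℕ} {f : Site2 → ℝ} (u : Site2 → ℝ)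
    (hf : ∀ x ∉ ΛN N, f x = 0) :
    edgeForm N u f = ∑ x ∈ ΛN N, f x *
      (4 * u x - ∑ i : Fin 2, (u (x + Pi.single i 1) + u (x - Pi.single i 1))) := by
  have hi (i : Fin 2) : ∑ x ∈ latBox (-1) ((N : ℤ) - 1),
      (u x - u (x + Pi.single i 1)) * (f x - f (x + Pi.single i 1)) =
      ∑ x ∈ ΛN N, f x * (2 * u x - (u (x + Pi.single i 1) + u (x - Pi.single i 1))) := by
    have h1 : ∑ x ∈ latBox (-1) ((N : ℤ) - 1), f x * (u x - u (x + Pi.single i 1)) =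
        ∑ x ∈ ΛN N, f x * (u x - u (x + Pi.single i 1)) :=
      (Finset.sum_subset (fun x hx => mem_outer_of_mem_ΛN hx)
        fun x _ hx => by rw [hf x hx, zero_mul]).symm
    have h2 := sum_outer_shift (N := N) (fun x => f x * (u x - u (x - Pi.single i 1)))
      (fun x hx => by rw [hf x hx, zero_mul]) i
    simp only [add_sub_cancel_right] at h2
    calc _ = ∑ x ∈ latBox (-1) ((N : ℤ) - 1), (f x * (u x - u (x + Pi.single i 1)) +
          f (x + Pi.single i 1) * (u (x + Pi.single i 1) - u x)) :=
          Finset.sum_congr rfl fun x _ => by ring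
      _ = _ := by
          rw [Finset.sum_add_distrib, h1, h2, ← Finset.sum_add_distrib]
          exact Finset.sum_congr rfl fun x _ => by ring
  rw [edgeForm, Finset.sum_comm, Finset.sum_congr rfl fun i _ => hi i, Finset.sum_comm]
  refine Finset.sum_congr rfl fun x _ => ?_
  simp only [Fin.sum_univ_two]
  ring

lemma dirLap_apply_eq (Λ : Finset Site2) (x y : Λ) :
    dirLap Λ x y = 4 * (if (y : Site2) = x then 1 else 0) - ∑ i : Fin 2,
      ((if (y : Site2) = (x : Site2) + Pi.single i 1 then 1 else 0) +
        (if (y : Site2) = (x : Site2) - Pi.single i 1 then 1 else 0)) := by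
  obtain ⟨x, hx⟩ := x
  obtain ⟨y, hy⟩ := y
  simp only [dirLap, l1dist, Int.abs_eq_natAbs, Fin.sum_univ_two, funext_iff,
    Fin.forall_fin_two, Pi.add_apply, Pi.sub_apply, Pi.single_eq_same, ne_eq, one_ne_zero,
    zero_ne_one, not_false_eq_true, Pi.single_eq_of_ne, add_zero, sub_zero]
  split_ifs <;> first | omega | norm_num

lemma sum_dirLap_mul (Λ : Finset Site2) {u : Site2 → ℝ} (hu : ∀ x ∉ Λ, u x = 0) (x : Λ) :
    ∑ y : Λ, dirLap Λ x y * u y =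
      4 * u x - ∑ i : Fin 2,
        (u ((x : Site2) + Pi.single i 1) + u ((x : Site2) - Pi.single i 1)) := by
  have hδ (w : Site2) : ∑ y : Λ, (if (y : Site2) = w then (1 : ℝ) else 0) * u y = u w := by
    rw [Finset.sum_coe_sort Λ (fun y => (if y = w then (1 : ℝ) else 0) * u y)]
    simp only [ite_mul, one_mul, zero_mul, Finset.sum_ite_eq']
    split_ifs with h
    · rfl
    · exact (hu w h).symm
  simp only [dirLap_apply_eq, Fin.sum_univ_two, sub_mul, add_mul, mul_assoc,
    Finset.sum_sub_distrib, Finset.sum_add_distrib, ← Finset.mul_sum, hδ]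

lemma eq_zero_of_edgeForm_self_eq_zero {N : ℕ} {u : Site2 → ℝ} (hu : ∀ x ∉ ΛN N, u x = 0)
    (h : edgeForm N u u = 0) (x : Site2) : u x = 0 := by
  have hstep : ∀ x ∈ ΛN N, u x = u (x + Pi.single 0 1) := by
    intro x hx
    rw [edgeForm, Finset.sum_eq_zero_iff_of_nonneg
      (fun x _ => Finset.sum_nonneg fun i _ => mul_self_nonneg _)] at h
    have h' := h x (mem_outer_of_mem_ΛN hx)
    rw [Finset.sum_eq_zero_iff_of_nonneg (fun i _ => mul_self_nonneg _)] at h'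
    exact sub_eq_zero.1 (mul_self_eq_zero.1 (h' 0 (Finset.mem_univ _)))
  have key (n : ℕ) : ∀ x : Site2, (N : ℤ) - 1 - x 0 < n → u x = 0 := by
    induction n with
    | zero =>
      intro x hx
      refine hu x fun hmem => ?_
      rw [ΛN, mem_latBox] at hmem
      push_cast at hx
      omega
    | succ n ih =>
      intro x hx
      by_cases hmem : x ∈ ΛN N
      · rw [hstep x hmem]
        refine ih _ ?_
        simp only [Pi.add_apply, Pi.single_eq_same]
        push_cast at hx
        omega
      · exact hu x hmem
  exact key ((N : ℤ) - x 0).toNat x (by omega)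

lemma isUnit_dirLap_ΛN (N : ℕ) : IsUnit (dirLap (ΛN N)) := by
  rw [← Matrix.mulVec_injective_iff_isUnit]
  refine (injective_iff_map_eq_zero (Matrix.mulVecLin (dirLap (ΛN N)))).2 fun v hv => ?_
  set u : Site2 → ℝ := fun x => if hx : x ∈ ΛN N then v ⟨x, hx⟩ else 0 with hu_def
  have huv (y : ΛN N) : u y = v y := by simp [hu_def]
  have hu : ∀ x ∉ ΛN N, u x = 0 := fun x hx => by simp [hu_def, hx]
  have h0 : edgeForm N u u = 0 := by
    rw [edgeForm_eq_sum_mul_laplacian u hu]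
    refine Finset.sum_eq_zero fun x hx => ?_
    have hx0 := congrFun hv ⟨x, hx⟩
    rw [Matrix.mulVecLin_apply, Matrix.mulVec, dotProduct] at hx0
    rw [← sum_dirLap_mul (ΛN N) hu ⟨x, hx⟩]
    simp only [huv]
    rw [hx0, Pi.zero_apply, mul_zero]
  ext y
  rw [← huv, eq_zero_of_edgeForm_self_eq_zero hu h0, Pi.zero_apply]

lemma greenN_eq_zero {N : ℕ} {x : Site2} (hx : x ∉ ΛN N) (z : Site2) : greenN N x z = 0 := by
  simp [greenN, hx]

/-- The Green function reproduces point evaluation in the Dirichlet form. -/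
lemma edgeForm_greenN {N : ℕ} {f : Site2 → ℝ} (hf : ∀ x ∉ ΛN N, f x = 0) {z : Site2}
    (hz : z ∈ ΛN N) : edgeForm N (fun x => greenN N x z) f = f z := by
  rw [edgeForm_eq_sum_mul_laplacian _ hf]
  have h (x : ΛN N) : 4 * greenN N x z - ∑ i : Fin 2,
      (greenN N ((x : Site2) + Pi.single i 1) z + greenN N ((x : Site2) - Pi.single i 1) z) =
      if x = ⟨z, hz⟩ then 1 else 0 := by
    rw [← sum_dirLap_mul (ΛN N) (u := fun x => greenN N x z) (fun x hx => greenN_eq_zero hx z) x,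
      ← Matrix.one_apply,
      ← Matrix.mul_nonsing_inv _ ((Matrix.isUnit_iff_isUnit_det _).1 (isUnit_dirLap_ΛN N)),
      Matrix.mul_apply]
    refine Finset.sum_congr rfl fun y _ => ?_
    simp [greenN, hz]
  rw [← Finset.sum_coe_sort (ΛN N), Finset.sum_congr rfl fun x _ => by rw [h x]]
  simp

lemma gradGradSum_eq_sum_edgeForm (N : ℕ) :
    gradGradSum N =
      ∑ z ∈ ΛN N, edgeForm N (fun x => greenN N x z) (fun x => greenN N x z) := by
  have h (x : Site2) (i : Fin 2) :
      (if x ∈ ΛN N ∨ x + Pi.single i 1 ∈ ΛN N then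
        ∑ z ∈ ΛN N, (greenN N x z - greenN N (x + Pi.single i 1) z) ^ 2 else 0) =
      ∑ z ∈ ΛN N, (greenN N x z - greenN N (x + Pi.single i 1) z) *
        (greenN N x z - greenN N (x + Pi.single i 1) z) := by
    split_ifs with hx
    · exact Finset.sum_congr rfl fun z _ => sq _
    · push Not at hx
      simp [greenN_eq_zero hx.1, greenN_eq_zero hx.2]
  simp only [gradGradSum, edgeForm, h]
  rw [Finset.sum_comm (s := ΛN N)]
  exact Finset.sum_congr rfl fun x _ => Finset.sum_comm

lemma edgeForm_self_nonneg (N : ℕ) (u : Site2 → ℝ) : 0 ≤ edgeForm N u u :=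
  Finset.sum_nonneg fun _ _ => Finset.sum_nonneg fun _ _ => mul_self_nonneg _

lemma edgeForm_self_ge (N : ℕ) (u f : Site2 → ℝ) (t : ℝ) :
    2 * t * edgeForm N u f - t ^ 2 * edgeForm N f f ≤ edgeForm N u u := by
  have h := edgeForm_self_nonneg N (fun x => u x - t * f x)
  have h' : edgeForm N (fun x => u x - t * f x) (fun x => u x - t * f x) =
      edgeForm N u u - 2 * t * edgeForm N u f + t ^ 2 * edgeForm N f f := by
    simp only [edgeForm, Finset.mul_sum, ← Finset.sum_sub_distrib, ← Finset.sum_add_distrib]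
    exact Finset.sum_congr rfl fun _ _ => Finset.sum_congr rfl fun _ _ => by ring
  linarith

/-- The harmonic tail `∑_{n ≤ k < R} 1/(k+1)`. -/
def harmonicTail (R n : ℕ) : ℝ := ∑ k ∈ Finset.Ico n R, 1 / ((k : ℝ) + 1)

lemma harmonicTail_of_le {R n : ℕ} (h : R ≤ n) : harmonicTail R n = 0 := by
  simp [harmonicTail, h]

lemma harmonicTail_sub_succ (R n : ℕ) :
    harmonicTail R n - harmonicTail R (n + 1) = if n < R then 1 / ((n : ℝ) + 1) else 0 := by
  split_ifs with h
  · rw [harmonicTail, Finset.sum_eq_sum_Ico_succ_bot h, harmonicTail]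
    ring
  · rw [harmonicTail_of_le (by omega), harmonicTail_of_le (by omega), sub_zero]

/-- The distance from `0` of the unit interval `[a, a + 1]`. -/
def edgeDist (a : ℤ) : ℕ := min a.natAbs (a + 1).natAbs

lemma sq_harmonicTail_sub_le (R : ℕ) (a b : ℤ) :
    (harmonicTail R (max a.natAbs b.natAbs) - harmonicTail R (max (a + 1).natAbs b.natAbs)) *
      (harmonicTail R (max a.natAbs b.natAbs) - harmonicTail R (max (a + 1).natAbs b.natAbs)) ≤
    if edgeDist a < R then
      (if b.natAbs ≤ edgeDist a then (1 / ((edgeDist a : ℝ) + 1)) ^ 2 else 0) else 0 := by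
  rcases le_or_gt b.natAbs (edgeDist a) with hb | hb
  · have hsq : (harmonicTail R (edgeDist a) - harmonicTail R (edgeDist a + 1)) ^ 2 =
        if edgeDist a < R then (1 / ((edgeDist a : ℝ) + 1)) ^ 2 else 0 := by
      rw [harmonicTail_sub_succ]
      split_ifs <;> simp
    rw [if_pos hb, ← hsq]
    have hb' := hb
    unfold edgeDist at hb'
    rcases le_or_gt 0 a with ha | ha
    · rw [show max a.natAbs b.natAbs = edgeDist a by unfold edgeDist; omega,
        show max (a + 1).natAbs b.natAbs = edgeDist a + 1 by unfold edgeDist; omega, sq]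
    · rw [show max a.natAbs b.natAbs = edgeDist a + 1 by unfold edgeDist; omega,
        show max (a + 1).natAbs b.natAbs = edgeDist a by unfold edgeDist; omega]
      exact le_of_eq (by ring)
  · rw [show max a.natAbs b.natAbs = max (a + 1).natAbs b.natAbs by unfold edgeDist at hb; omega,
      sub_self, zero_mul]
    split_ifs <;> positivity

lemma sum_Ico_edgeDist (φ : ℕ → ℝ) (R : ℕ) :
    ∑ a ∈ Finset.Ico (-(R : ℤ)) R, φ (edgeDist a) = 2 * ∑ k ∈ Finset.range R, φ k := by
  induction R with
  | zero => simp
  | succ R ih =>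
    have hIco : Finset.Ico (-((R + 1 : ℕ) : ℤ)) ((R + 1 : ℕ) : ℤ) =
        insert (-(R : ℤ) - 1) (insert (R : ℤ) (Finset.Ico (-(R : ℤ)) R)) := by
      ext a
      simp only [Finset.mem_insert, Finset.mem_Ico]
      push_cast
      omega
    rw [hIco, Finset.sum_insert (by simp), Finset.sum_insert (by simp), ih,
      Finset.sum_range_succ, show edgeDist (-(R : ℤ) - 1) = R by unfold edgeDist; omega,
      show edgeDist (R : ℤ) = R by unfold edgeDist; omega]
    ring

lemma sum_sum_edgeDist_le (s t : Finset ℤ) (p q : ℤ) (R : ℕ) :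
    ∑ a ∈ s, ∑ b ∈ t, (if edgeDist (a - p) < R then
      (if (b - q).natAbs ≤ edgeDist (a - p) then (1 / ((edgeDist (a - p) : ℝ) + 1)) ^ 2 else 0)
      else 0) ≤ 4 * harmonicTail R 0 := by
  have hinner (a : ℤ) : ∑ b ∈ t, (if edgeDist (a - p) < R then
      (if (b - q).natAbs ≤ edgeDist (a - p) then (1 / ((edgeDist (a - p) : ℝ) + 1)) ^ 2 else 0)
      else 0) ≤ if edgeDist (a - p) < R then 2 * (1 / ((edgeDist (a - p) : ℝ) + 1)) else 0 := by
    split_ifs with h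
    · generalize edgeDist (a - p) = m
      rw [← Finset.sum_filter, Finset.sum_const, nsmul_eq_mul]
      have hcard : (t.filter fun b => (b - q).natAbs ≤ m).card ≤ 2 * m + 1 := by
        calc _ ≤ (Finset.Icc (q - m) (q + m)).card := Finset.card_le_card fun b hb => by
              simp only [Finset.mem_filter] at hb
              rw [Finset.mem_Icc]
              omega
          _ = 2 * m + 1 := by rw [Int.card_Icc]; omega
      have hcard' : ((t.filter fun b => (b - q).natAbs ≤ m).card : ℝ) ≤ 2 * ((m : ℝ) + 1) := by
        have : ((t.filter fun b => (b - q).natAbs ≤ m).card : ℝ) ≤ 2 * m + 1 := by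
          exact_mod_cast hcard
        linarith
      calc _ ≤ 2 * ((m : ℝ) + 1) * (1 / ((m : ℝ) + 1)) ^ 2 := by gcongr
        _ = _ := by field_simp
    · simp
  calc _ ≤ ∑ a ∈ s, if edgeDist (a - p) < R then 2 * (1 / ((edgeDist (a - p) : ℝ) + 1)) else 0 :=
        Finset.sum_le_sum fun a _ => hinner a
    _ = ∑ a ∈ s.filter (fun a => edgeDist (a - p) < R),
          2 * (1 / ((edgeDist (a - p) : ℝ) + 1)) := (Finset.sum_filter _ _).symm
    _ ≤ ∑ a ∈ (Finset.Ico (-(R : ℤ)) R).map (addRightEmbedding p),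
          2 * (1 / ((edgeDist (a - p) : ℝ) + 1)) := by
        refine Finset.sum_le_sum_of_subset_of_nonneg (fun a ha => ?_) fun _ _ _ => by positivity
        have ha' := (Finset.mem_filter.1 ha).2
        unfold edgeDist at ha'
        rw [Finset.mem_map]
        exact ⟨a - p, by rw [Finset.mem_Ico]; omega, by simp⟩
    _ = 4 * harmonicTail R 0 := by
        rw [Finset.sum_map]
        simp only [addRightEmbedding_apply, add_sub_cancel_right]
        rw [sum_Ico_edgeDist (fun k => 2 * (1 / ((k : ℝ) + 1))), ← Finset.mul_sum, harmonicTail,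
          Nat.Ico_zero_eq_range]
        ring

lemma sum_latBox (A B : ℤ) (F : Site2 → ℝ) :
    ∑ x ∈ latBox A B, F x = ∑ a ∈ Finset.Icc A B, ∑ b ∈ Finset.Icc A B, F ![a, b] := by
  rw [← Finset.sum_product' (Finset.Icc A B) (Finset.Icc A B) (fun a b => F ![a, b])]
  refine Finset.sum_bij' (fun x _ => (x 0, x 1)) (fun p _ => ![p.1, p.2]) ?_ ?_ ?_ ?_ ?_
  · intro x hx
    simpa [mem_latBox] using hx
  · intro p hp
    simpa [mem_latBox] using hp
  · intro x _
    ext i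
    fin_cases i <;> rfl
  · intro p _
    rfl
  · intro x _
    congr 1
    ext i
    fin_cases i <;> rfl

/-- The logarithmic test function centred at `z`, a function of the sup-norm distance to `z`
supported on the sites at distance less than `R`. -/
def logTest (R : ℕ) (z x : Site2) : ℝ :=
  harmonicTail R (max (x 0 - z 0).natAbs (x 1 - z 1).natAbs)

lemma edgeForm_logTest_le (N R : ℕ) (z : Site2) :
    edgeForm N (logTest R z) (logTest R z) ≤ 8 * harmonicTail R 0 := by
  rw [edgeForm, Finset.sum_comm, Fin.sum_univ_two, sum_latBox, sum_latBox]
  have h0 := sum_sum_edgeDist_le (Finset.Icc (-1) ((N : ℤ) - 1)) (Finset.Icc (-1) ((N : ℤ) - 1))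
    (z 0) (z 1) R
  have h1 := sum_sum_edgeDist_le (Finset.Icc (-1) ((N : ℤ) - 1)) (Finset.Icc (-1) ((N : ℤ) - 1))
    (z 1) (z 0) R
  rw [show 8 * harmonicTail R 0 = 4 * harmonicTail R 0 + 4 * harmonicTail R 0 by ring]
  refine add_le_add (le_trans ?_ h0) (le_trans ?_ h1)
  · refine Finset.sum_le_sum fun a _ => Finset.sum_le_sum fun b _ => ?_
    have := sq_harmonicTail_sub_le R (a - z 0) (b - z 1)
    simpa [logTest, sub_add_eq_add_sub] using this
  · rw [Finset.sum_comm]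
    refine Finset.sum_le_sum fun a _ => Finset.sum_le_sum fun b _ => ?_
    have := sq_harmonicTail_sub_le R (a - z 1) (b - z 0)
    simpa [logTest, sub_add_eq_add_sub, max_comm] using this

/-- Lower bound for the energy of the Green function at sites at distance at least `R` from the
complement of `Λ_N`. -/
lemma edgeForm_greenN_self_ge {N R : ℕ} {z : Site2} (hR : 1 ≤ R)
    (hz : z ∈ latBox ((R : ℤ) - 1) ((N : ℤ) - R)) :
    harmonicTail R 0 / 8 ≤ edgeForm N (fun x => greenN N x z) (fun x => greenN N x z) := by
  rw [mem_latBox] at hz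
  have hzΛ : z ∈ ΛN N := by
    rw [ΛN, mem_latBox]
    omega
  have hf : ∀ x ∉ ΛN N, logTest R z x = 0 := by
    intro x hx
    rw [ΛN, mem_latBox] at hx
    exact harmonicTail_of_le (by omega)
  have h := edgeForm_self_ge N (fun x => greenN N x z) (logTest R z) (1 / 8)
  rw [edgeForm_greenN hf hzΛ, show logTest R z z = harmonicTail R 0 by simp [logTest]] at h
  linarith [edgeForm_logTest_le N R z]

lemma log_add_one_le_harmonicTail (R : ℕ) : Real.log (R + 1) ≤ harmonicTail R 0 := by
  have h := log_add_one_le_harmonic R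
  simpa [harmonicTail, harmonic] using h

lemma card_latBox (a b : ℤ) : (latBox a b).card = (b + 1 - a).toNat ^ 2 := by
  simp [latBox, Fintype.card_piFinset]

lemma gradGradSum_ge {N : ℕ} (hN : 1 ≤ N) :
    1 / 64 * (N : ℝ) ^ 2 * Real.log N ≤ gradGradSum N := by
  obtain ⟨R, hR⟩ : ∃ R : ℕ, R = N / 4 + 1 := ⟨_, rfl⟩
  have hN' : (1 : ℝ) ≤ N := by exact_mod_cast hN
  have hlog : Real.log N / 2 ≤ harmonicTail R 0 := by
    refine le_trans ?_ (log_add_one_le_harmonicTail R)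
    have h4 : ((N : ℝ) + 5) / 4 ≤ R + 1 := by
      have : N + 5 ≤ 4 * (R + 1) := by omega
      have : (N : ℝ) + 5 ≤ 4 * (R + 1) := by exact_mod_cast this
      linarith
    have hsq : (N : ℝ) ≤ ((R : ℝ) + 1) ^ 2 := by nlinarith [sq_nonneg ((N : ℝ) - 3)]
    have := Real.log_le_log (by linarith) hsq
    rw [Real.log_pow] at this
    push_cast at this
    linarith
  have hcard : ((N : ℝ) / 2) ^ 2 ≤ ((latBox ((R : ℤ) - 1) ((N : ℤ) - R)).card : ℝ) := by
    rw [card_latBox]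
    push_cast
    have : N ≤ 2 * ((N : ℤ) - R + 1 - ((R : ℤ) - 1)).toNat := by omega
    have : (N : ℝ) ≤ 2 * (((N : ℤ) - R + 1 - ((R : ℤ) - 1)).toNat : ℝ) := by exact_mod_cast this
    gcongr
    linarith
  have hlog0 : 0 ≤ Real.log N := Real.log_nonneg hN'
  calc 1 / 64 * (N : ℝ) ^ 2 * Real.log N = ((N : ℝ) / 2) ^ 2 * (Real.log N / 2 / 8) := by ring
    _ ≤ ((latBox ((R : ℤ) - 1) ((N : ℤ) - R)).card : ℝ) * (harmonicTail R 0 / 8) := by gcongr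
    _ = ∑ z ∈ latBox ((R : ℤ) - 1) ((N : ℤ) - R), harmonicTail R 0 / 8 := by
        rw [Finset.sum_const, nsmul_eq_mul]
    _ ≤ ∑ z ∈ latBox ((R : ℤ) - 1) ((N : ℤ) - R),
          edgeForm N (fun x => greenN N x z) (fun x => greenN N x z) :=
        Finset.sum_le_sum fun z hz => edgeForm_greenN_self_ge (by omega) hz
    _ ≤ ∑ z ∈ ΛN N, edgeForm N (fun x => greenN N x z) (fun x => greenN N x z) := by
        refine Finset.sum_le_sum_of_subset_of_nonneg (fun z hz => ?_)
          fun z _ _ => edgeForm_self_nonneg N _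
        rw [mem_latBox] at hz
        rw [ΛN, mem_latBox]
        omega
    _ = gradGradSum N := (gradGradSum_eq_sum_edgeForm N).symm

/-- In two dimensions there is `c > 0` such that for all `N ≥ 2`,
`Σ_e Σ_{z∈Λ_N} (G_N(x_e,z) − G_N(y_e,z))² ≥ c N² log N`; in particular the per-site value
of this double-gradient of `Δ_{Λ_N}^{-2}` diverges as `N → ∞`. -/
theorem gradGrad_inv_sq_dirLap_lower_bound :
    (∃ c : ℝ, 0 < c ∧ ∀ N : ℕ, 2 ≤ N →
      c * (N : ℝ) ^ 2 * Real.log N ≤ gradGradSum N) ∧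
    Tendsto (fun N : ℕ => gradGradSum N / (N : ℝ) ^ 2) atTop atTop := by
  refine ⟨⟨1 / 64, by norm_num, fun N hN => gradGradSum_ge (by omega)⟩, ?_⟩
  refine tendsto_atTop_mono' _ ?_ ((Real.tendsto_log_atTop.comp
    tendsto_natCast_atTop_atTop).const_mul_atTop (by norm_num : (0 : ℝ) < 1 / 64))
  filter_upwards [eventually_ge_atTop 1] with N hN
  have hN' : (0 : ℝ) < N := by exact_mod_cast hN
  rw [Function.comp_apply, le_div_iff₀ (by positivity)]
  linarith [gradGradSum_ge hN]

end
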